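/- Let H be a doubly Noetherian Hopf algebra acting on a finitely generated graded quadratic algebra S preserving the grading. Then every PBW deformation of S#H is a strong PBW deformation: if a filtered algebra B = T_H(H⊗V⊗H)/(P∪P') satisfies gr B ≅ S#H via some graded algebra isomorphism, then the canonical graded epimorphism S#H → gr B is an isomorphism. -/

import Mathlib

open scoped TensorProduct

noncomputable section

namespace PaperTH

variable (k H V : Type*) [CommRing k] [Ring H] [AddCommGroup V] [Module k V]

section AlgebraPart
variable [Algebra k H]

/-- The free algebra on the `k`-module `H ⊕ V`; the tensor algebra over `H` of the free
`H`-bimodule `H ⊗ V ⊗ H` is the quotient of this by the relations `baseSet` below. -/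
abbrev TF := TensorAlgebra k (H × V)

/-- The `H`-generators. -/
noncomputable def jH : H →ₗ[k] TF k H V := (TensorAlgebra.ι k).comp (LinearMap.inl k H V)

/-- The `V`-generators (degree 1). -/
noncomputable def jV : V →ₗ[k] TF k H V := (TensorAlgebra.ι k).comp (LinearMap.inr k H V)

/-- Presentation relation: the relations making `H ↪ T_H(H⊗V⊗H)` an algebra map, together
with an arbitrary set `Q` of further relations set equal to `0`.  Thus
`RingQuot (presRel Q)` models `T_H(H⊗V⊗H)/(Q)`. -/
inductive presRel (Q : Set (TF k H V)) : TF k H V → TF k H V → Prop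
  | mulH (h h' : H) : presRel Q (jH k H V h * jH k H V h') (jH k H V (h * h'))
  | oneH : presRel Q (jH k H V 1) 1
  | mem {x : TF k H V} : x ∈ Q → presRel Q x 0

/-- Elements generating the two-sided ideal presenting `T_H(H⊗V⊗H)` from the free algebra. -/
def baseSet : Set (TF k H V) :=
  {x | (∃ h h', x = jH k H V h * jH k H V h' - jH k H V (h * h')) ∨ x = jH k H V 1 - 1}

/-- The two-sided ideal generated by a set, as a `k`-submodule. -/
noncomputable def twoSidedSpan {A : Type*} [Ring A] [Algebra k A] (s : Set A) :
    Submodule k A :=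
  Submodule.span k {x | ∃ a p b, p ∈ s ∧ x = a * p * b}

/-- Degree-0 piece `H` (with its unit). -/
noncomputable def HF : Submodule k (TF k H V) := LinearMap.range (jH k H V) ⊔ 1

/-- The `V`-part. -/
noncomputable def VF : Submodule k (TF k H V) := LinearMap.range (jV k H V)

/-- Degree-`n` piece of `T_H(H⊗V⊗H)`: sums of `h₀ v₁ h₁ ⋯ v_n h_n`. -/
noncomputable def gradeF (n : ℕ) : Submodule k (TF k H V) :=
  HF k H V * (VF k H V * HF k H V) ^ n

/-- Filtration `F_n`. -/
noncomputable def filtF (n : ℕ) : Submodule k (TF k H V) := ⨆ i ≤ n, gradeF k H V i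

/-- `F_{n-1}` (with `F_{-1} = ⊥`). -/
noncomputable def filtFpred (n : ℕ) : Submodule k (TF k H V) := ⨆ i < n, gradeF k H V i

/-- The image of `V ⊗ V` in degree 2. -/
noncomputable def iVV : V ⊗[k] V →ₗ[k] TF k H V :=
  (LinearMap.mul' k (TF k H V)).comp (TensorProduct.map (jV k H V) (jV k H V))

/-- The image of `V ⊗ H` in degree 1. -/
noncomputable def iVH : V ⊗[k] H →ₗ[k] TF k H V :=
  (LinearMap.mul' k (TF k H V)).comp (TensorProduct.map (jV k H V) (jH k H V))

end AlgebraPart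

section BialgebraPart
variable [Bialgebra k H]

/-- The twisting map `τ : H ⊗ V → V ⊗ H`, `h ⊗ v ↦ Σ (h₁ · v) ⊗ h₂`. -/
noncomputable def twistTau (act : H ⊗[k] V →ₗ[k] V) :
    H ⊗[k] V →ₗ[k] V ⊗[k] H :=
  (TensorProduct.map act LinearMap.id)
    ∘ₗ (TensorProduct.assoc k H V H).symm.toLinearMap
    ∘ₗ (TensorProduct.map LinearMap.id (TensorProduct.comm k H V).toLinearMap)
    ∘ₗ (TensorProduct.assoc k H H V).toLinearMap
    ∘ₗ (TensorProduct.map Coalgebra.comul LinearMap.id)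

/-- The diagonal action of `H` on `V ⊗ V`. -/
noncomputable def diag2 (act : H ⊗[k] V →ₗ[k] V) :
    H ⊗[k] (V ⊗[k] V) →ₗ[k] V ⊗[k] V :=
  (TensorProduct.map act act)
    ∘ₗ (TensorProduct.tensorTensorTensorComm k H H V V).toLinearMap
    ∘ₗ (TensorProduct.map Coalgebra.comul LinearMap.id)

/-- The span of the smash relations `h ⊗ v ⊗ 1 − 1 ⊗ τ(h ⊗ v)`, viewed inside `TF`. -/
noncomputable def smashSet (act : H ⊗[k] V →ₗ[k] V) : Set (TF k H V) :=
  (Submodule.span k {x | ∃ (h : H) (v : V),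
    x = jH k H V h * jV k H V v - iVH k H V (twistTau k H V act (h ⊗ₜ[k] v))} :
      Submodule k (TF k H V))

end BialgebraPart

end PaperTH

end

open PaperTH

noncomputable section

variable (k H V : Type*) [CommRing k] [Ring H] [Bialgebra k H]
  [AddCommGroup V] [Module k V]

/-- The homogeneous relations `R ∪ R'` presenting `S#H = T_H(H⊗V⊗H)/(R ∪ R')`. -/
noncomputable def fullRels (R : Submodule k (V ⊗[k] V)) (actV : H ⊗[k] V →ₗ[k] V) :
    Set (TF k H V) :=
  (iVV k H V '' (R : Set (V ⊗[k] V))) ∪ smashSet k H V actV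

/-- The filtered (deformed) relations `P ∪ P'` of a PBW deformation `H_{λ,α,β}`:
`P' = {r − λ(r) : r ∈ R'}` and `P = {r − α(r) − β(r) : r ∈ R}`. -/
noncomputable def defRels (R : Submodule k (V ⊗[k] V)) (actV : H ⊗[k] V →ₗ[k] V)
    (lam : TF k H V →ₗ[k] TF k H V) (α β : V ⊗[k] V →ₗ[k] TF k H V) :
    Set (TF k H V) :=
  {x | ∃ y ∈ smashSet k H V actV, x = y - lam y} ∪
  {x | ∃ r ∈ R, x = iVV k H V r - α r - β r}

/-- The two-sided ideal (as a `k`-subspace) presenting `S#H` from the free algebra. -/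
noncomputable def idealA (R : Submodule k (V ⊗[k] V)) (actV : H ⊗[k] V →ₗ[k] V) :
    Submodule k (TF k H V) :=
  twoSidedSpan k (baseSet k H V) ⊔ twoSidedSpan k (fullRels k H V R actV)

/-- The two-sided ideal (as a `k`-subspace) presenting `H_{λ,α,β}` from the free algebra. -/
noncomputable def idealB (R : Submodule k (V ⊗[k] V)) (actV : H ⊗[k] V →ₗ[k] V)
    (lam : TF k H V →ₗ[k] TF k H V) (α β : V ⊗[k] V →ₗ[k] TF k H V) :
    Submodule k (TF k H V) :=
  twoSidedSpan k (baseSet k H V) ⊔ twoSidedSpan k (defRels k H V R actV lam α β)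

/-- Degree-`n` piece of `S#H`. -/
noncomputable def homP (R : Submodule k (V ⊗[k] V)) (actV : H ⊗[k] V →ₗ[k] V) (n : ℕ) :
    Submodule k (TF k H V ⧸ idealA k H V R actV) :=
  Submodule.map (idealA k H V R actV).mkQ (gradeF k H V n)

/-- Degree-`n` piece `F_n(B)/F_{n-1}(B)` of `gr B` for `B = H_{λ,α,β}`. -/
noncomputable def grP (R : Submodule k (V ⊗[k] V)) (actV : H ⊗[k] V →ₗ[k] V)
    (lam : TF k H V →ₗ[k] TF k H V) (α β : V ⊗[k] V →ₗ[k] TF k H V) (n : ℕ) :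
    Submodule k (TF k H V ⧸ (idealB k H V R actV lam α β ⊔ filtFpred k H V n)) :=
  Submodule.map (idealB k H V R actV lam α β ⊔ filtFpred k H V n).mkQ (filtF k H V n)

end


section Helpers19

lemma aux_abstract {H M : Type*} [Ring H] [IsNoetherianRing Hᵐᵒᵖ] [AddCommGroup M]
    (ψ : M →+ M) (hsurj : Function.Surjective ψ) (r : H → M →+ M)
    (radd : ∀ a b m, r (a + b) m = r a m + r b m)
    (rone : ∀ m, r 1 m = m)
    (rmul : ∀ a b m, r (a * b) m = r b (r a m))
    (s : Set M) (hs : s.Finite)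
    (hgen : ∀ N : AddSubgroup M, s ⊆ N → (∀ h, ∀ m ∈ N, r h m ∈ N) → ∀ m, m ∈ N)
    (hcomm : ∀ h, ∃ h', ∀ m, ψ (r h m) = r h' (ψ m)) :
    Function.Injective ψ := by
  let _ : Module Hᵐᵒᵖ M :=
    { smul := fun a m => r a.unop m
      one_smul := fun m => rone m
      mul_smul := fun a b m => rmul b.unop a.unop m
      smul_zero := fun a => map_zero _
      smul_add := fun a => map_add _
      add_smul := fun a b m => radd _ _ m
      zero_smul := fun m => by
        have h := radd 0 0 m
        rw [add_zero] at h
        exact left_eq_add.mp h }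
  have hsm : ∀ (a : Hᵐᵒᵖ) (m : M), a • m = r a.unop m := fun _ _ => rfl
  have hfin : Module.Finite Hᵐᵒᵖ M := by
    refine ⟨⟨hs.toFinset, ?_⟩⟩
    rw [Set.Finite.coe_toFinset, eq_top_iff]
    intro m _
    refine hgen (Submodule.span Hᵐᵒᵖ s).toAddSubgroup (fun x hx => Submodule.subset_span hx) ?_ m
    intro h m hm
    exact (Submodule.span Hᵐᵒᵖ s).smul_mem (MulOpposite.op h) hm
  have hN : IsNoetherian Hᵐᵒᵖ M := inferInstance
  have hiter : ∀ (j : ℕ) (m m' : M), ψ^[j] (m + m') = ψ^[j] m + ψ^[j] m' := by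
    intro j
    induction j with
    | zero => intros; rfl
    | succ j ih => intro m m'; simp
  have hiter0 : ∀ (j : ℕ), ψ^[j] 0 = 0 := by
    intro j
    induction j with
    | zero => rfl
    | succ j ih => simp
  have hiterr : ∀ (j : ℕ) (h : H), ∃ h', ∀ m, ψ^[j] (r h m) = r h' (ψ^[j] m) := by
    intro j
    induction j with
    | zero => intro h; exact ⟨h, fun _ => rfl⟩
    | succ j ih =>
      intro h
      obtain ⟨h1, e1⟩ := hcomm h
      obtain ⟨h2, e2⟩ := ih h1
      refine ⟨h2, fun m => ?_⟩
      simp [e1, e2]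
  let K : ℕ →o Submodule Hᵐᵒᵖ M :=
    { toFun := fun j =>
        { carrier := {m | ψ^[j] m = 0}
          add_mem' := by
            intro a b ha hb
            simp only [Set.mem_ofPred_eq] at *
            rw [hiter, ha, hb, add_zero]
          zero_mem' := hiter0 j
          smul_mem' := by
            intro c m hm
            obtain ⟨h', e⟩ := hiterr j c.unop
            simp only [Set.mem_ofPred_eq] at *
            rw [hsm, e, hm, map_zero] }
      monotone' := by
        refine monotone_nat_of_le_succ ?_
        intro j m hm
        change ψ^[j+1] m = 0
        change ψ^[j] m = 0 at hm
        rw [Function.iterate_succ_apply', hm, map_zero] }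
  obtain ⟨j, hj⟩ := monotone_stabilizes_iff_noetherian.mpr hN K
  rw [injective_iff_map_eq_zero]
  intro m hm
  obtain ⟨y, rfl⟩ := (hsurj.iterate j) m
  have h1 : y ∈ K (j + 1) := by
    change ψ^[j+1] y = 0
    rw [Function.iterate_succ_apply', hm]
  rw [← hj (j + 1) (Nat.le_succ j)] at h1
  exact h1

lemma aux_noeth (k H : Type*) [Field k] [Ring H] [HopfAlgebra k H]
    [IsNoetherianRing (H ⊗[k] Hᵐᵒᵖ)] : IsNoetherianRing Hᵐᵒᵖ := by
  let f : H ⊗[k] Hᵐᵒᵖ →ₐ[k] Hᵐᵒᵖ :=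
    Algebra.TensorProduct.lift ((Algebra.ofId k Hᵐᵒᵖ).comp (Bialgebra.counitAlgHom k H))
      (AlgHom.id k Hᵐᵒᵖ) (fun x y => Algebra.commutes (Coalgebra.counit (R := k) x) y)
  refine isNoetherianRing_of_surjective (H ⊗[k] Hᵐᵒᵖ) Hᵐᵒᵖ f.toRingHom ?_
  intro x
  refine ⟨1 ⊗ₜ x, ?_⟩
  change f (1 ⊗ₜ x) = x
  refine (Algebra.TensorProduct.lift_tmul _ _ _ _ _).trans ?_
  rw [map_one, one_mul, AlgHom.id_apply]

section TS
variable {k A : Type*} [CommRing k] [Ring A] [Algebra k A]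

lemma aux_tss_sub (s : Set A) {x : A} (hx : x ∈ s) : x ∈ twoSidedSpan k s :=
  Submodule.subset_span ⟨1, x, 1, hx, by simp⟩

lemma aux_tss_left (s : Set A) (a : A) {x : A} (hx : x ∈ twoSidedSpan k s) :
    a * x ∈ twoSidedSpan k s := by
  unfold twoSidedSpan at *
  induction hx using Submodule.span_induction with
  | mem x h =>
    obtain ⟨c, p, b, hp, rfl⟩ := h
    exact Submodule.subset_span ⟨a * c, p, b, hp, by simp [mul_assoc]⟩
  | zero => simp
  | add x y _ _ h1 h2 => rw [mul_add]; exact add_mem h1 h2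
  | smul c x _ h => rw [mul_smul_comm]; exact Submodule.smul_mem _ _ h

lemma aux_tss_right (s : Set A) (a : A) {x : A} (hx : x ∈ twoSidedSpan k s) :
    x * a ∈ twoSidedSpan k s := by
  unfold twoSidedSpan at *
  induction hx using Submodule.span_induction with
  | mem x h =>
    obtain ⟨c, p, b, hp, rfl⟩ := h
    exact Submodule.subset_span ⟨c, p, b * a, hp, by simp [mul_assoc]⟩
  | zero => simp
  | add x y _ _ h1 h2 => rw [add_mul]; exact add_mem h1 h2
  | smul c x _ h => rw [smul_mul_assoc]; exact Submodule.smul_mem _ _ h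

lemma aux_tss_sup_left (s t : Set A) (a : A) {x : A}
    (hx : x ∈ twoSidedSpan k s ⊔ twoSidedSpan k t) :
    a * x ∈ twoSidedSpan k s ⊔ twoSidedSpan k t := by
  obtain ⟨y, hy, z, hz, rfl⟩ := Submodule.mem_sup.mp hx
  rw [mul_add]
  exact Submodule.add_mem_sup (aux_tss_left s a hy) (aux_tss_left t a hz)

lemma aux_tss_sup_right (s t : Set A) (a : A) {x : A}
    (hx : x ∈ twoSidedSpan k s ⊔ twoSidedSpan k t) :
    x * a ∈ twoSidedSpan k s ⊔ twoSidedSpan k t := by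
  obtain ⟨y, hy, z, hz, rfl⟩ := Submodule.mem_sup.mp hx
  rw [add_mul]
  exact Submodule.add_mem_sup (aux_tss_right s a hy) (aux_tss_right t a hz)

end TS

section Alg
variable {k H V : Type*} [CommRing k] [Ring H] [Algebra k H] [AddCommGroup V] [Module k V]

lemma aux_one_HF : (1 : TF k H V) ∈ HF k H V :=
  Submodule.mem_sup_right (Submodule.mem_one.mpr ⟨1, map_one _⟩)

lemma aux_jH_HF (h : H) : jH k H V h ∈ HF k H V := Submodule.mem_sup_left ⟨h, rfl⟩

lemma aux_jV_VF (v : V) : jV k H V v ∈ VF k H V := ⟨v, rfl⟩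

lemma aux_jH_one : jH k H V 1 - 1 ∈ twoSidedSpan k (baseSet k H V) :=
  aux_tss_sub _ (Or.inr rfl)

/-- every element of `HF` is congruent to some `jH h`. -/
lemma aux_HF_rep {x : TF k H V} (hx : x ∈ HF k H V) :
    ∃ h : H, x - jH k H V h ∈ twoSidedSpan k (baseSet k H V) := by
  obtain ⟨y, ⟨h, rfl⟩, z, hz, rfl⟩ := Submodule.mem_sup.mp hx
  obtain ⟨c, rfl⟩ := Submodule.mem_one.mp hz
  refine ⟨h + c • 1, ?_⟩
  have : jH k H V h + algebraMap k _ c - jH k H V (h + c • 1)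
      = -(c • (jH k H V 1 - 1)) := by
    rw [map_add, map_smul, Algebra.algebraMap_eq_smul_one, smul_sub]; abel
  rw [this]
  exact neg_mem (Submodule.smul_mem _ _ aux_jH_one)

lemma aux_HF_mul : HF k H V * HF k H V ≤ HF k H V ⊔ twoSidedSpan k (baseSet k H V) := by
  rw [Submodule.mul_le]
  intro x hx y hy
  obtain ⟨h, h1⟩ := aux_HF_rep hx
  obtain ⟨h', h2⟩ := aux_HF_rep hy
  have e : x * y = jH k H V (h * h') + ((x - jH k H V h) * y
      + (jH k H V h * (y - jH k H V h')
      + (jH k H V h * jH k H V h' - jH k H V (h * h')))) := by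
    noncomm_ring
  rw [e]
  refine Submodule.add_mem_sup (aux_jH_HF _) (add_mem (aux_tss_right _ _ h1)
    (add_mem (aux_tss_left _ _ h2) (aux_tss_sub _ (Or.inl ⟨h, h', rfl⟩))))

lemma aux_tss_mul_le (s : Set (TF k H V)) (P : Submodule k (TF k H V)) :
    twoSidedSpan k s * P ≤ twoSidedSpan k s := by
  rw [Submodule.mul_le]; intro x hx y _; exact aux_tss_right _ _ hx

lemma aux_mul_tss_le (s : Set (TF k H V)) (P : Submodule k (TF k H V)) :
    P * twoSidedSpan k s ≤ twoSidedSpan k s := by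
  rw [Submodule.mul_le]; intro x _ y hy; exact aux_tss_left _ _ hy

/-- homogeneous piece modulo the base relations -/
noncomputable def EE (k H V : Type*) [CommRing k] [Ring H] [Algebra k H] [AddCommGroup V] [Module k V]
    (n : ℕ) : Submodule k (TF k H V) :=
  gradeF k H V n ⊔ twoSidedSpan k (baseSet k H V)

lemma aux_grade_mul_HF (n : ℕ) : gradeF k H V n * HF k H V ≤ EE k H V n := by
  unfold gradeF EE
  cases n with
  | zero => simpa [gradeF] using aux_HF_mul
  | succ n =>
    unfold gradeF
    rw [pow_succ]
    calc _ = HF k H V * (VF k H V * HF k H V) ^ n * VF k H V * (HF k H V * HF k H V) := by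
            simp only [mul_assoc]
      _ ≤ HF k H V * (VF k H V * HF k H V) ^ n * VF k H V *
          (HF k H V ⊔ twoSidedSpan k (baseSet k H V)) := by gcongr; exact aux_HF_mul
      _ ≤ _ := by
        rw [Submodule.mul_sup]
        refine sup_le_sup ?_ (aux_mul_tss_le _ _)
        simp only [mul_assoc]; exact le_rfl

lemma aux_EE_mul (m n : ℕ) : EE k H V m * EE k H V n ≤ EE k H V (m + n) := by
  have key : gradeF k H V m * gradeF k H V n ≤ EE k H V (m + n) := by
    calc gradeF k H V m * gradeF k H V n
        = (gradeF k H V m * HF k H V) * (VF k H V * HF k H V) ^ n := by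
          simp only [gradeF, mul_assoc]
      _ ≤ EE k H V m * (VF k H V * HF k H V) ^ n := by gcongr; exact aux_grade_mul_HF m
      _ ≤ _ := by
        unfold EE
        rw [Submodule.sup_mul]
        refine sup_le_sup ?_ (aux_tss_mul_le _ _)
        simp only [gradeF, pow_add, mul_assoc]; exact le_rfl
  nth_rewrite 1 [EE]
  rw [Submodule.sup_mul]
  refine sup_le ?_ ((aux_tss_mul_le _ _).trans le_sup_right)
  nth_rewrite 1 [EE]
  rw [Submodule.mul_sup]
  exact sup_le key ((aux_mul_tss_le _ _).trans le_sup_right)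

lemma aux_grade_zero : gradeF k H V 0 = HF k H V := by simp [gradeF]

lemma aux_VF_pow (n : ℕ) : VF k H V ^ n ≤ gradeF k H V n := by
  have h1 : (1 : Submodule k (TF k H V)) ≤ HF k H V := le_sup_right
  unfold gradeF
  calc VF k H V ^ n = 1 * (VF k H V * 1) ^ n := by simp
    _ ≤ _ := by gcongr

lemma aux_jV_EE (v : V) : jV k H V v ∈ EE k H V 1 := by
  refine Submodule.mem_sup_left (aux_VF_pow 1 ?_)
  rw [pow_one]; exact aux_jV_VF v

lemma aux_HF_EE {x : TF k H V} (h : x ∈ HF k H V) : x ∈ EE k H V 0 := by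
  refine Submodule.mem_sup_left ?_
  rw [aux_grade_zero]; exact h

open Polynomial in
/-- grading homomorphism -/
noncomputable def GG (k H V : Type*) [CommRing k] [Ring H] [Algebra k H] [AddCommGroup V] [Module k V] :
    TF k H V →ₐ[k] Polynomial (TF k H V) :=
  TensorAlgebra.lift k
    (((Polynomial.monomial 0).restrictScalars k ∘ₗ jH k H V).coprod
      ((Polynomial.monomial 1).restrictScalars k ∘ₗ jV k H V))

lemma GG_jH (h : H) : GG k H V (jH k H V h) = Polynomial.monomial 0 (jH k H V h) := by
  simp only [GG]
  conv_lhs => rw [jH]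
  simp [jH]

lemma GG_jV (v : V) : GG k H V (jV k H V v) = Polynomial.monomial 1 (jV k H V v) := by
  simp only [GG]
  conv_lhs => rw [jV]
  simp [jV]

/-- homogeneous elements -/
def DD (k H V : Type*) [CommRing k] [Ring H] [Algebra k H] [AddCommGroup V] [Module k V]
    (n : ℕ) : Submodule k (TF k H V) where
  carrier := {x | GG k H V x = Polynomial.monomial n x}
  add_mem' := by
    intro a b ha hb
    simp only [Set.mem_ofPred_eq] at *
    simp [ha, hb]
  zero_mem' := by simp
  smul_mem' := by
    intro c x hx
    simp only [Set.mem_ofPred_eq] at *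
    rw [map_smul, hx, Polynomial.smul_monomial]

lemma DD_mul (m n : ℕ) : DD k H V m * DD k H V n ≤ DD k H V (m + n) := by
  rw [Submodule.mul_le]
  intro x hx y hy
  change GG k H V _ = _ at hx hy
  change GG k H V _ = _
  rw [map_mul, hx, hy, Polynomial.monomial_mul_monomial]

lemma DD_HF : HF k H V ≤ DD k H V 0 := by
  refine sup_le ?_ ?_
  · rintro _ ⟨h, rfl⟩; exact GG_jH h
  · intro x hx
    obtain ⟨c, rfl⟩ := Submodule.mem_one.mp hx
    change GG k H V _ = _
    rw [AlgHom.commutes]; rfl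

lemma DD_VF : VF k H V ≤ DD k H V 1 := by
  rintro _ ⟨v, rfl⟩; exact GG_jV v

lemma DD_grade (n : ℕ) : gradeF k H V n ≤ DD k H V n := by
  induction n with
  | zero => rw [aux_grade_zero]; exact DD_HF
  | succ n ih =>
    calc gradeF k H V (n + 1) = gradeF k H V n * (VF k H V * HF k H V) := by
          simp only [gradeF, pow_succ, mul_assoc]
      _ ≤ DD k H V n * (DD k H V 1 * DD k H V 0) := by
          gcongr
          · exact DD_VF
          · exact DD_HF
      _ ≤ DD k H V n * DD k H V (1 + 0) := by gcongr; exact DD_mul _ _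
      _ ≤ _ := DD_mul _ _

lemma GG_coeff_EE (a : TF k H V) : ∀ i, (GG k H V a).coeff i ∈ EE k H V i := by
  induction a using TensorAlgebra.induction with
  | algebraMap r =>
    intro i
    rw [AlgHom.commutes, Polynomial.algebraMap_apply, Polynomial.coeff_C]
    split_ifs with h
    · subst h
      refine aux_HF_EE (Submodule.mem_sup_right ?_)
      exact Submodule.mem_one.mpr ⟨r, rfl⟩
    · exact zero_mem _
  | ι x =>
    intro i
    obtain ⟨h, v⟩ := x
    have : TensorAlgebra.ι k (h, v) = jH k H V h + jV k H V v := by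
      simp [jH, jV, ← map_add]
    rw [this, map_add, GG_jH, GG_jV, Polynomial.coeff_add, Polynomial.coeff_monomial,
      Polynomial.coeff_monomial]
    refine add_mem ?_ ?_
    · split_ifs with h
      · subst h; exact aux_HF_EE (aux_jH_HF _)
      · exact zero_mem _
    · split_ifs with h
      · subst h; exact aux_jV_EE _
      · exact zero_mem _
  | mul a b ha hb =>
    intro i
    rw [map_mul, Polynomial.coeff_mul]
    refine sum_mem fun p hp => ?_
    rw [← Finset.HasAntidiagonal.mem_antidiagonal.mp hp]
    exact aux_EE_mul _ _ (Submodule.mul_mem_mul (ha _) (hb _))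
  | add a b ha hb =>
    intro i
    rw [map_add, Polynomial.coeff_add]
    exact add_mem (ha i) (hb i)

/-- coefficient of `a p b` with `p` homogeneous -/
lemma GG_apb (S : Submodule k (TF k H V)) (n d : ℕ) (a p b : TF k H V) (hp : p ∈ DD k H V d)
    (hS : ∀ i j, i + d + j = n → ∀ x ∈ EE k H V i, ∀ y ∈ EE k H V j, x * p * y ∈ S) :
    (GG k H V (a * p * b)).coeff n ∈ S := by
  change GG k H V p = _ at hp
  rw [map_mul, map_mul, hp, Polynomial.coeff_mul]
  refine sum_mem fun q hq => ?_
  rw [Polynomial.coeff_mul, Finset.sum_mul]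
  refine sum_mem fun r hr => ?_
  rw [Polynomial.coeff_monomial]
  split_ifs with h
  · refine hS r.1 q.2 ?_ _ (GG_coeff_EE _ _) _ (GG_coeff_EE _ _)
    rw [h, Finset.HasAntidiagonal.mem_antidiagonal.mp hr, Finset.HasAntidiagonal.mem_antidiagonal.mp hq]
  · simp

lemma base_DD {x : TF k H V} (hx : x ∈ baseSet k H V) : x ∈ DD k H V 0 := by
  rcases hx with ⟨h, h', rfl⟩ | rfl
  · exact sub_mem (DD_mul 0 0 (Submodule.mul_mem_mul (DD_HF (aux_jH_HF _)) (DD_HF (aux_jH_HF _))))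
      (DD_HF (aux_jH_HF _))
  · exact sub_mem (DD_HF (aux_jH_HF _)) (DD_HF aux_one_HF)

lemma tss_coeff (s : Set (TF k H V)) (S : Submodule k (TF k H V)) (n : ℕ)
    (h : ∀ p ∈ s, ∃ d, p ∈ DD k H V d ∧
      ∀ i j, i + d + j = n → ∀ x ∈ EE k H V i, ∀ y ∈ EE k H V j, x * p * y ∈ S)
    {x : TF k H V} (hx : x ∈ twoSidedSpan k s) : (GG k H V x).coeff n ∈ S := by
  unfold twoSidedSpan at hx
  induction hx using Submodule.span_induction with
  | mem x hx =>
    obtain ⟨a, p, b, hp, rfl⟩ := hx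
    obtain ⟨d, h1, h2⟩ := h p hp
    exact GG_apb S n d a p b h1 h2
  | zero => simp
  | add x y _ _ h1 h2 => rw [map_add, Polynomial.coeff_add]; exact add_mem h1 h2
  | smul c x _ h => rw [map_smul, Polynomial.coeff_smul]; exact Submodule.smul_mem _ _ h

lemma filt_split (n : ℕ) : filtF k H V n ≤ gradeF k H V n ⊔ filtFpred k H V n := by
  unfold filtF
  refine iSup₂_le fun i hi => ?_
  rcases hi.eq_or_lt with rfl | h
  · exact le_sup_left
  · exact le_sup_of_le_right (le_iSup₂_of_le (f := fun i (_ : i < n) => gradeF k H V i) i h le_rfl)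

lemma grade_le_filt (n : ℕ) : gradeF k H V n ≤ filtF k H V n :=
  le_iSup₂_of_le (f := fun i (_ : i ≤ n) => gradeF k H V i) n le_rfl le_rfl

lemma EE_le (J : Submodule k (TF k H V)) (hJ : twoSidedSpan k (baseSet k H V) ≤ J)
    {l n : ℕ} (h : l < n) : EE k H V l ≤ J ⊔ filtFpred k H V n :=
  sup_le (le_sup_of_le_right
    (le_iSup₂_of_le (f := fun i (_ : i < n) => gradeF k H V i) l h le_rfl))
    (hJ.trans le_sup_left)

end Alg

section Bi
variable {k H V : Type*} [CommRing k] [Ring H] [Bialgebra k H] [AddCommGroup V] [Module k V]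
  (R : Submodule k (V ⊗[k] V)) (actV : H ⊗[k] V →ₗ[k] V)

lemma iVV_DD (r : V ⊗[k] V) : iVV k H V r ∈ DD k H V 2 := by
  induction r using TensorProduct.induction_on with
  | zero => simp
  | tmul x y =>
    simp only [iVV, LinearMap.comp_apply, TensorProduct.map_tmul, LinearMap.mul'_apply]
    exact DD_mul 1 1 (Submodule.mul_mem_mul (DD_VF (aux_jV_VF _)) (DD_VF (aux_jV_VF _)))
  | add x y hx hy => rw [map_add]; exact add_mem hx hy

lemma iVH_mem (r : V ⊗[k] H) : iVH k H V r ∈ VF k H V * HF k H V := by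
  induction r using TensorProduct.induction_on with
  | zero => simp
  | tmul x y =>
    simp only [iVH, LinearMap.comp_apply, TensorProduct.map_tmul, LinearMap.mul'_apply]
    exact Submodule.mul_mem_mul (aux_jV_VF _) (aux_jH_HF _)
  | add x y hx hy => rw [map_add]; exact add_mem hx hy

lemma smash_DD {y : TF k H V} (hy : y ∈ smashSet k H V actV) : y ∈ DD k H V 1 := by
  have : smashSet k H V actV ⊆ (DD k H V 1 : Set (TF k H V)) := by
    unfold smashSet
    rw [SetLike.coe_subset_coe, Submodule.span_le]
    rintro x ⟨h, v, rfl⟩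
    refine sub_mem ?_ ?_
    · exact DD_mul 0 1 (Submodule.mul_mem_mul (DD_HF (aux_jH_HF _)) (DD_VF (aux_jV_VF _)))
    · exact DD_mul 1 0 (mul_le_mul' DD_VF DD_HF (iVH_mem _))
  exact this hy

lemma welldef (lam : TF k H V →ₗ[k] TF k H V) (α β : V ⊗[k] V →ₗ[k] TF k H V)
    (hlam : ∀ x, lam x ∈ HF k H V)
    (hα : ∀ r : V ⊗[k] V, α r ∈ gradeF k H V 1)
    (hβ : ∀ r : V ⊗[k] V, β r ∈ HF k H V) (n : ℕ) {x : TF k H V}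
    (hx : x ∈ idealA k H V R actV) :
    (GG k H V x).coeff n ∈ idealB k H V R actV lam α β ⊔ filtFpred k H V n := by
  have hbase : twoSidedSpan k (baseSet k H V) ≤ idealB k H V R actV lam α β := le_sup_left
  have hdef : twoSidedSpan k (defRels k H V R actV lam α β) ≤ idealB k H V R actV lam α β :=
    le_sup_right
  have mul3 : ∀ {i l j : ℕ} {x y z : TF k H V}, i + l + j < n → x ∈ EE k H V i →
      y ∈ EE k H V l → z ∈ EE k H V j →
      x * y * z ∈ idealB k H V R actV lam α β ⊔ filtFpred k H V n := by
    intro i l j x y z h hx hy hz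
    exact EE_le _ hbase h (aux_EE_mul _ _ (Submodule.mul_mem_mul
      (aux_EE_mul _ _ (Submodule.mul_mem_mul hx hy)) hz))
  unfold idealA at hx
  obtain ⟨y, hy, z, hz, rfl⟩ := Submodule.mem_sup.mp hx
  rw [map_add, Polynomial.coeff_add]
  refine add_mem ?_ ?_
  · refine tss_coeff _ _ n ?_ hy
    intro p hp
    refine ⟨0, base_DD hp, fun i j _ x _ y _ => ?_⟩
    exact Submodule.mem_sup_left (hbase (aux_tss_right _ _ (aux_tss_left _ _ (aux_tss_sub _ hp))))
  · refine tss_coeff _ _ n ?_ hz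
    rintro p (⟨r, hr, rfl⟩ | hp)
    · refine ⟨2, iVV_DD r, fun i j hn x hx y hy => ?_⟩
      have e : x * iVV k H V r * y = x * (iVV k H V r - α r - β r) * y
          + (x * α r * y + x * β r * y) := by noncomm_ring
      rw [e]
      refine add_mem (Submodule.mem_sup_left (hdef (aux_tss_right _ _ (aux_tss_left _ _
        (aux_tss_sub _ (Or.inr ⟨r, hr, rfl⟩)))))) (add_mem ?_ ?_)
      · exact mul3 (i := i) (l := 1) (j := j) (by omega) hx (Submodule.mem_sup_left (hα r)) hy
      · exact mul3 (i := i) (l := 0) (j := j) (by omega) hx (aux_HF_EE (hβ r)) hy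
    · refine ⟨1, smash_DD actV hp, fun i j hn x hx y hy => ?_⟩
      have e : x * p * y = x * (p - lam p) * y + x * lam p * y := by noncomm_ring
      rw [e]
      refine add_mem (Submodule.mem_sup_left (hdef (aux_tss_right _ _ (aux_tss_left _ _
        (aux_tss_sub _ (Or.inl ⟨p, hp, rfl⟩)))))) ?_
      exact mul3 (i := i) (l := 0) (j := j) (by omega) hx (aux_HF_EE (hlam p)) hy

lemma base_le_A : twoSidedSpan k (baseSet k H V) ≤ idealA k H V R actV := le_sup_left

lemma A_left (a : TF k H V) {x : TF k H V} (hx : x ∈ idealA k H V R actV) :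
    a * x ∈ idealA k H V R actV := aux_tss_sup_left _ _ a hx

lemma A_right (a : TF k H V) {x : TF k H V} (hx : x ∈ idealA k H V R actV) :
    x * a ∈ idealA k H V R actV := aux_tss_sup_right _ _ a hx

lemma A_mul_le (P : Submodule k (TF k H V)) :
    idealA k H V R actV * P ≤ idealA k H V R actV := by
  rw [Submodule.mul_le]; intro x hx y _; exact A_right R actV _ hx

lemma mul_A_le (P : Submodule k (TF k H V)) :
    P * idealA k H V R actV ≤ idealA k H V R actV := by
  rw [Submodule.mul_le]; intro x _ y hy; exact A_left R actV _ hy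

lemma HV_swap : HF k H V * VF k H V ≤ VF k H V * HF k H V ⊔ idealA k H V R actV := by
  rw [Submodule.mul_le]
  rintro x hx _ ⟨v, rfl⟩
  obtain ⟨h, hh⟩ := aux_HF_rep hx
  have e : x * jV k H V v = iVH k H V (twistTau k H V actV (h ⊗ₜ[k] v)) +
    ((x - jH k H V h) * jV k H V v + (jH k H V h * jV k H V v -
      iVH k H V (twistTau k H V actV (h ⊗ₜ[k] v)))) := by noncomm_ring
  rw [e]
  refine Submodule.add_mem_sup (iVH_mem _) (add_mem (A_right _ _ _ (base_le_A _ _ hh)) ?_)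
  refine Submodule.mem_sup_right (aux_tss_sub _ (Or.inr ?_))
  exact Submodule.subset_span ⟨h, v, rfl⟩

lemma grade_le_VH (n : ℕ) :
    gradeF k H V n ≤ VF k H V ^ n * HF k H V ⊔ idealA k H V R actV := by
  induction n with
  | zero => simp [gradeF]
  | succ n ih =>
    calc gradeF k H V (n + 1) = gradeF k H V n * (VF k H V * HF k H V) := by
          simp only [gradeF, pow_succ, mul_assoc]
      _ ≤ (VF k H V ^ n * HF k H V ⊔ idealA k H V R actV) * (VF k H V * HF k H V) := by gcongr
      _ ≤ VF k H V ^ n * (HF k H V * VF k H V) * HF k H V ⊔ idealA k H V R actV := by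
          rw [Submodule.sup_mul]
          refine sup_le_sup ?_ (A_mul_le _ _ _)
          simp only [mul_assoc]; exact le_rfl
      _ ≤ VF k H V ^ n * (VF k H V * HF k H V ⊔ idealA k H V R actV) * HF k H V
            ⊔ idealA k H V R actV := by gcongr; exact HV_swap R actV
      _ ≤ VF k H V ^ (n + 1) * (HF k H V * HF k H V) ⊔ idealA k H V R actV := by
          refine sup_le ?_ le_sup_right
          rw [Submodule.mul_sup, Submodule.sup_mul]
          refine sup_le_sup ?_ ((mul_le_mul_left (mul_A_le _ _ _) _).trans (A_mul_le _ _ _))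
          simp only [pow_succ, mul_assoc]; exact le_rfl
      _ ≤ VF k H V ^ (n + 1) * (HF k H V ⊔ idealA k H V R actV) ⊔ idealA k H V R actV := by
          gcongr
          exact aux_HF_mul.trans (sup_le_sup le_rfl (base_le_A _ _))
      _ ≤ _ := by
          refine sup_le ?_ le_sup_right
          rw [Submodule.mul_sup]
          exact sup_le_sup le_rfl (mul_A_le _ _ _)

variable (lam : TF k H V →ₗ[k] TF k H V) (α β : V ⊗[k] V →ₗ[k] TF k H V)
    (hlam : ∀ x, lam x ∈ HF k H V)
    (hα : ∀ r : V ⊗[k] V, α r ∈ gradeF k H V 1)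
    (hβ : ∀ r : V ⊗[k] V, β r ∈ HF k H V)

/-- The canonical map on the whole quotient (through the degree `n` projection). -/
noncomputable def phiFull (n : ℕ) : (TF k H V ⧸ idealA k H V R actV) →ₗ[k]
    (TF k H V ⧸ (idealB k H V R actV lam α β ⊔ filtFpred k H V n)) :=
  (idealA k H V R actV).liftQ
    ((idealB k H V R actV lam α β ⊔ filtFpred k H V n).mkQ ∘ₗ
      ((Polynomial.lcoeff (TF k H V) n).restrictScalars k) ∘ₗ (GG k H V).toLinearMap)
    (fun x hx => by
      rw [LinearMap.mem_ker]
      exact (Submodule.Quotient.mk_eq_zero _).mpr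
        (welldef R actV lam α β hlam hα hβ n hx))

lemma phiFull_mk (n : ℕ) {x : TF k H V} (hx : x ∈ DD k H V n) :
    phiFull R actV lam α β hlam hα hβ n ((idealA k H V R actV).mkQ x)
      = (idealB k H V R actV lam α β ⊔ filtFpred k H V n).mkQ x := by
  change GG k H V x = _ at hx
  simp only [phiFull, Submodule.mkQ_apply, Submodule.liftQ_apply, LinearMap.comp_apply]
  congr 1
  simp [hx]

/-- The canonical map in degree `n`. -/
noncomputable def phi (n : ℕ) : homP k H V R actV n →ₗ[k] grP k H V R actV lam α β n :=
  (phiFull R actV lam α β hlam hα hβ n).restrict (by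
    rintro _ ⟨x, hx, rfl⟩
    rw [phiFull_mk _ _ _ _ _ _ _ _ _ (DD_grade n hx)]
    exact ⟨x, grade_le_filt n hx, rfl⟩)

lemma phi_mk (n : ℕ) {x : TF k H V} (hx : x ∈ DD k H V n)
    (h1 : (idealA k H V R actV).mkQ x ∈ homP k H V R actV n)
    (h2 : (idealB k H V R actV lam α β ⊔ filtFpred k H V n).mkQ x
      ∈ grP k H V R actV lam α β n) :
    phi R actV lam α β hlam hα hβ n ⟨_, h1⟩ = ⟨_, h2⟩ :=
  Subtype.ext (phiFull_mk R actV lam α β hlam hα hβ n hx)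

lemma phi_surj (n : ℕ) : Function.Surjective (phi R actV lam α β hlam hα hβ n) := by
  rintro ⟨_, y, hy, rfl⟩
  obtain ⟨g, hg, l, hl, rfl⟩ := Submodule.mem_sup.mp (filt_split n hy)
  refine ⟨⟨_, g, hg, rfl⟩, Subtype.ext ?_⟩
  refine (phiFull_mk R actV lam α β hlam hα hβ n (DD_grade n hg)).trans ?_
  change _ = (idealB k H V R actV lam α β ⊔ filtFpred k H V n).mkQ (g + l)
  rw [map_add, left_eq_add]
  exact (Submodule.Quotient.mk_eq_zero _).mpr (Submodule.mem_sup_right hl)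

lemma EE_homP {n : ℕ} {x : TF k H V} (hx : x ∈ EE k H V n) :
    (idealA k H V R actV).mkQ x ∈ homP k H V R actV n := by
  obtain ⟨g, hg, l, hl, rfl⟩ := Submodule.mem_sup.mp hx
  refine ⟨g, hg, ?_⟩
  rw [map_add, left_eq_add]
  exact (Submodule.Quotient.mk_eq_zero _).mpr (base_le_A _ _ hl)

lemma homP_rep {n : ℕ} (m : homP k H V R actV n) : ∃ (y : TF k H V) (hy : y ∈ gradeF k H V n),
    m = ⟨(idealA k H V R actV).mkQ y, EE_homP R actV (Submodule.mem_sup_left hy)⟩ := by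
  obtain ⟨_, y, hy, rfl⟩ := m
  exact ⟨y, hy, rfl⟩

lemma EE_grP {n : ℕ} {x : TF k H V} (hx : x ∈ EE k H V n) :
    (idealB k H V R actV lam α β ⊔ filtFpred k H V n).mkQ x ∈ grP k H V R actV lam α β n := by
  obtain ⟨g, hg, l, hl, rfl⟩ := Submodule.mem_sup.mp hx
  refine ⟨g, grade_le_filt n hg, ?_⟩
  rw [map_add, left_eq_add]
  exact (Submodule.Quotient.mk_eq_zero _).mpr
    (Submodule.mem_sup_left (Submodule.mem_sup_left hl))

lemma grade_mul_jH {n : ℕ} {x : TF k H V} (hx : x ∈ gradeF k H V n) (h : H) :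
    x * jH k H V h ∈ EE k H V n :=
  aux_grade_mul_HF n (Submodule.mul_mem_mul hx (aux_jH_HF h))

/-- Right multiplication by `h` on the degree `n` piece. -/
noncomputable def rr (n : ℕ) (h : H) : homP k H V R actV n →ₗ[k] homP k H V R actV n :=
  ((idealA k H V R actV).mapQ (idealA k H V R actV) (LinearMap.mulRight k (jH k H V h))
    (fun _ hx => A_right R actV _ hx)).restrict (by
    rintro _ ⟨x, hx, rfl⟩
    exact EE_homP R actV (grade_mul_jH hx h))

lemma rr_mk (n : ℕ) (h : H) {x : TF k H V}
    (h1 : (idealA k H V R actV).mkQ x ∈ homP k H V R actV n)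
    (h2 : (idealA k H V R actV).mkQ (x * jH k H V h) ∈ homP k H V R actV n) :
    rr R actV n h ⟨_, h1⟩ = ⟨_, h2⟩ := rfl

lemma mk_congr {x y : TF k H V} (h : x - y ∈ idealA k H V R actV) :
    (idealA k H V R actV).mkQ x = (idealA k H V R actV).mkQ y :=
  (Submodule.Quotient.eq _).mpr h

lemma rr_coe (n : ℕ) (h : H) (m : homP k H V R actV n) {x : TF k H V}
    (hx : (idealA k H V R actV).mkQ x = m) :
    (rr R actV n h m : TF k H V ⧸ idealA k H V R actV) =
      (idealA k H V R actV).mkQ (x * jH k H V h) := by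
  obtain ⟨m, hm⟩ := m
  subst hx
  rfl

lemma rr_add (n : ℕ) (a b : H) (m : homP k H V R actV n) :
    rr R actV n (a + b) m = rr R actV n a m + rr R actV n b m := by
  obtain ⟨_, x, hx, rfl⟩ := m
  refine Subtype.ext ?_
  rw [Submodule.coe_add, rr_coe _ _ _ _ _ rfl, rr_coe _ _ _ _ _ rfl, rr_coe _ _ _ _ _ rfl,
    map_add, mul_add, map_add]

lemma rr_smul (n : ℕ) (c : k) (m : homP k H V R actV n) :
    rr R actV n (c • 1) m = c • m := by
  obtain ⟨_, x, hx, rfl⟩ := m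
  refine Subtype.ext ?_
  rw [Submodule.coe_smul, rr_coe _ _ _ _ _ rfl, map_smul, mul_smul_comm, map_smul]
  congr 1
  refine mk_congr _ _ ?_
  have : x * jH k H V 1 - x = x * (jH k H V 1 - 1) := by noncomm_ring
  rw [this]
  exact A_left _ _ _ (base_le_A _ _ aux_jH_one)

lemma rr_one (n : ℕ) (m : homP k H V R actV n) : rr R actV n 1 m = m := by
  have := rr_smul R actV n 1 m
  simpa using this

lemma rr_mul (n : ℕ) (a b : H) (m : homP k H V R actV n) :
    rr R actV n (a * b) m = rr R actV n b (rr R actV n a m) := by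
  obtain ⟨_, x, hx, rfl⟩ := m
  refine Subtype.ext ?_
  rw [rr_coe _ _ _ _ _ rfl, rr_coe R actV n b _ (x := x * jH k H V a) rfl]
  refine (mk_congr _ _ ?_).symm
  have : x * jH k H V a * jH k H V b - x * jH k H V (a * b)
    = x * (jH k H V a * jH k H V b - jH k H V (a * b)) := by noncomm_ring
  rw [this]
  exact A_left _ _ _ (base_le_A _ _ (aux_tss_sub _ (Or.inl ⟨a, b, rfl⟩)))

lemma rr_gen [Module.Finite k V] (n : ℕ) :
    ∃ s : Set (homP k H V R actV n), s.Finite ∧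
      ∀ N : AddSubgroup (homP k H V R actV n), s ⊆ N →
        (∀ h, ∀ m ∈ N, rr R actV n h m ∈ N) → ∀ m, m ∈ N := by
  have hfg : (VF k H V ^ n).FG := by
    refine Submodule.FG.pow ?_ n
    unfold VF
    rw [LinearMap.range_eq_map]
    exact Submodule.FG.map _ Module.Finite.fg_top
  obtain ⟨t, ht⟩ := hfg
  refine ⟨Subtype.val ⁻¹' ((idealA k H V R actV).mkQ '' (t : Set (TF k H V))), ?_, ?_⟩
  · exact (t.finite_toSet.image _).preimage Subtype.val_injective.injOn
  intro N hs hN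
  let N' : Submodule k (homP k H V R actV n) :=
    { N with
      smul_mem' := fun c m hm => by
        have := hN (c • 1) m hm
        rwa [rr_smul] at this }
  let N2 : Submodule k (TF k H V) :=
    (N'.map (homP k H V R actV n).subtype).comap (idealA k H V R actV).mkQ
  have hmem : ∀ x, x ∈ N2 ↔ ∃ m ∈ N, (m : TF k H V ⧸ idealA k H V R actV)
      = (idealA k H V R actV).mkQ x := fun x => Iff.rfl
  have hA : idealA k H V R actV ≤ N2 := by
    intro x hx
    refine (hmem x).mpr ⟨0, N.zero_mem, ?_⟩
    exact ((Submodule.Quotient.mk_eq_zero _).mpr hx).symm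
  have h1 : VF k H V ^ n ≤ N2 := by
    rw [← ht, Submodule.span_le]
    intro x hx
    have hx' : x ∈ VF k H V ^ n := by rw [← ht]; exact Submodule.subset_span hx
    exact (hmem x).mpr ⟨⟨_, x, aux_VF_pow n hx', rfl⟩, hs ⟨x, hx, rfl⟩, rfl⟩
  have h2 : VF k H V ^ n * HF k H V ≤ N2 := by
    rw [Submodule.mul_le]
    intro x hx y hy
    obtain ⟨h, hh⟩ := aux_HF_rep hy
    have e : x * y = x * jH k H V h + x * (y - jH k H V h) := by noncomm_ring
    rw [e]
    refine add_mem ?_ (hA (A_left _ _ _ (base_le_A _ _ hh)))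
    obtain ⟨m, hm, hmx⟩ := (hmem x).mp (h1 hx)
    exact (hmem _).mpr ⟨_, hN h m hm, rr_coe _ _ _ _ _ hmx.symm⟩
  rintro ⟨_, x, hx, rfl⟩
  obtain ⟨m, hm, hmx⟩ := (hmem x).mp ((sup_le h2 hA) (grade_le_VH R actV n hx))
  have : m = ⟨(idealA k H V R actV).mkQ x, x, hx, rfl⟩ := Subtype.ext hmx
  rw [← this]; exact hm

end Bi

end Helpers19

/-- Let `H` be a doubly Noetherian Hopf algebra acting on the finitely
generated graded quadratic algebra `S = T(V)/(R)` preserving the grading.  If a filtered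
algebra `B = T_H(H⊗V⊗H)/(P ∪ P')` (i.e. `B = H_{λ,α,β}`, presented by the filtered
relations `defRels`) satisfies `gr B ≅ S#H` via *some* graded algebra isomorphism
(a degreewise family of linear equivalences which is unital and multiplicative on
representatives), then `B` is a strong PBW deformation: the canonical graded epimorphism
`S#H → gr B` is an isomorphism, i.e. it is injective in every degree. -/
theorem stmt_19 {k H V : Type*} [Field k] [Ring H] [HopfAlgebra k H]
    [IsNoetherianRing (H ⊗[k] Hᵐᵒᵖ)]
    [AddCommGroup V] [Module k V] [Module.Finite k V]
    (R : Submodule k (V ⊗[k] V))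
    (actV : H ⊗[k] V →ₗ[k] V)
    (honeV : ∀ v : V, actV ((1 : H) ⊗ₜ[k] v) = v)
    (hmulV : ∀ (h h' : H) (v : V),
      actV ((h * h') ⊗ₜ[k] v) = actV (h ⊗ₜ[k] actV (h' ⊗ₜ[k] v)))
    (hRpres : ∀ h : H, ∀ r ∈ R, diag2 k H V actV (h ⊗ₜ[k] r) ∈ R)
    (lam : TF k H V →ₗ[k] TF k H V) (α β : V ⊗[k] V →ₗ[k] TF k H V)
    (hlam : ∀ x, lam x ∈ HF k H V)
    (hα : ∀ r : V ⊗[k] V, α r ∈ gradeF k H V 1)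
    (hβ : ∀ r : V ⊗[k] V, β r ∈ HF k H V)
    (hPBW : ∃ e : (n : ℕ) → (homP k H V R actV n ≃ₗ[k] grP k H V R actV lam α β n),
      (∀ (h1 : (idealA k H V R actV).mkQ 1 ∈ homP k H V R actV 0)
         (h1' : (idealB k H V R actV lam α β ⊔ filtFpred k H V 0).mkQ 1
            ∈ grP k H V R actV lam α β 0),
        e 0 ⟨(idealA k H V R actV).mkQ 1, h1⟩
          = ⟨(idealB k H V R actV lam α β ⊔ filtFpred k H V 0).mkQ 1, h1'⟩) ∧
      (∀ (m n : ℕ) (x y x' y' : TF k H V),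
        x ∈ gradeF k H V m → y ∈ gradeF k H V n →
        x' ∈ filtF k H V m → y' ∈ filtF k H V n →
        ∀ (hx : (idealA k H V R actV).mkQ x ∈ homP k H V R actV m)
          (hx' : (idealB k H V R actV lam α β ⊔ filtFpred k H V m).mkQ x'
              ∈ grP k H V R actV lam α β m)
          (hy : (idealA k H V R actV).mkQ y ∈ homP k H V R actV n)
          (hy' : (idealB k H V R actV lam α β ⊔ filtFpred k H V n).mkQ y'
              ∈ grP k H V R actV lam α β n)
          (hxy : (idealA k H V R actV).mkQ (x * y) ∈ homP k H V R actV (m + n))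
          (hxy' : (idealB k H V R actV lam α β ⊔ filtFpred k H V (m + n)).mkQ (x' * y')
              ∈ grP k H V R actV lam α β (m + n)),
        e m ⟨(idealA k H V R actV).mkQ x, hx⟩
            = ⟨(idealB k H V R actV lam α β ⊔ filtFpred k H V m).mkQ x', hx'⟩ →
        e n ⟨(idealA k H V R actV).mkQ y, hy⟩
            = ⟨(idealB k H V R actV lam α β ⊔ filtFpred k H V n).mkQ y', hy'⟩ →
        e (m + n) ⟨(idealA k H V R actV).mkQ (x * y), hxy⟩
            = ⟨(idealB k H V R actV lam α β ⊔ filtFpred k H V (m + n)).mkQ (x' * y'),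
                hxy'⟩)) :
    ∀ n, gradeF k H V n ⊓ (idealB k H V R actV lam α β ⊔ filtFpred k H V n)
      ≤ idealA k H V R actV := by
  have hNo : IsNoetherianRing Hᵐᵒᵖ := aux_noeth k H
  obtain ⟨e, -, hmul⟩ := hPBW
  intro n x hx
  obtain ⟨s, hsfin, hgen⟩ := rr_gen R actV n
  let ψ : homP k H V R actV n →+ homP k H V R actV n :=
    ((e n).symm.toLinearMap ∘ₗ phi R actV lam α β hlam hα hβ n).toAddMonoidHom
  have hψ : ∀ m, ψ m = (e n).symm (phi R actV lam α β hlam hα hβ n m) := fun _ => rfl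
  have hinj : Function.Injective ψ := by
    refine aux_abstract ψ ?_ (fun h => (rr R actV n h).toAddMonoidHom) (rr_add R actV n)
      (rr_one R actV n) (rr_mul R actV n) s hsfin hgen ?_
    · exact (e n).symm.surjective.comp (phi_surj R actV lam α β hlam hα hβ n)
    · intro h
      have hj : jH k H V h ∈ EE k H V 0 := aux_HF_EE (aux_jH_HF h)
      obtain ⟨h', eh'⟩ : ∃ h' : H, e 0 ⟨(idealA k H V R actV).mkQ (jH k H V h'),
          EE_homP R actV (aux_HF_EE (aux_jH_HF h'))⟩
          = ⟨_, EE_grP R actV lam α β hj⟩ := by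
        obtain ⟨m, e1⟩ := (e 0).surjective ⟨_, EE_grP R actV lam α β hj⟩
        obtain ⟨y, hy, rfl⟩ := homP_rep R actV m
        have hy' : y ∈ HF k H V := by rw [← aux_grade_zero]; exact hy
        obtain ⟨h', hh'⟩ := aux_HF_rep hy'
        refine ⟨h', ?_⟩
        rw [← e1]
        congr 1
        exact Subtype.ext (mk_congr R actV (base_le_A _ _ hh')).symm
      refine ⟨h', ?_⟩
      intro m
      obtain ⟨y, hy, rfl⟩ := homP_rep R actV m
      have hyE : y ∈ EE k H V n := Submodule.mem_sup_left hy
      change ψ (rr R actV n h _) = rr R actV n h' (ψ _)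
      rw [hψ, hψ, LinearEquiv.symm_apply_eq]
      rw [phi_mk R actV lam α β hlam hα hβ n (DD_grade n hy) _ (EE_grP R actV lam α β hyE)]
      obtain ⟨m, ez⟩ := (e n).surjective ⟨_, EE_grP R actV lam α β hyE⟩
      obtain ⟨z, hz, rfl⟩ := homP_rep R actV m
      rw [← ez, LinearEquiv.symm_apply_apply]
      have hyh := grade_mul_jH hy h
      have hzh := grade_mul_jH hz h'
      rw [rr_mk R actV n h _ (EE_homP R actV hyh), rr_mk R actV n h' _ (EE_homP R actV hzh)]
      have hyD : y * jH k H V h ∈ DD k H V n :=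
        DD_mul n 0 (Submodule.mul_mem_mul (DD_grade n hy) (DD_HF (aux_jH_HF h)))
      rw [phi_mk R actV lam α β hlam hα hβ n hyD _ (EE_grP R actV lam α β hyh)]
      have hj0 : ∀ a : H, jH k H V a ∈ gradeF k H V 0 := fun a => by
        rw [aux_grade_zero]; exact aux_jH_HF a
      exact (hmul n 0 z (jH k H V h') y (jH k H V h) hz (hj0 h') (grade_le_filt n hy)
        (grade_le_filt 0 (hj0 h)) _ _ _ _ (EE_homP R actV hzh) (EE_grP R actV lam α β hyh)
        ez eh').symm
  have hxg : x ∈ gradeF k H V n := hx.1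
  have hxE : x ∈ EE k H V n := Submodule.mem_sup_left hxg
  have h0 : ψ ⟨_, EE_homP R actV hxE⟩ = 0 := by
    rw [hψ, phi_mk R actV lam α β hlam hα hβ n (DD_grade n hxg) _ (EE_grP R actV lam α β hxE)]
    rw [LinearEquiv.symm_apply_eq, map_zero]
    exact Subtype.ext ((Submodule.Quotient.mk_eq_zero _).mpr hx.2)
  have h1 := hinj (h0.trans (map_zero ψ).symm)
  exact (Submodule.Quotient.mk_eq_zero _).mp (congrArg Subtype.val h1)
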